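/- arXiv:1910.04820 — 2 statements merged into one kernel-verified Lean document; each statement's English description precedes it below -/
import Mathlib

section
/- For every η ∈ (0,1) and all indices i, j, l ∈ {1,2,3} there exists a constant C > 0 such that for every t > 0 and all k₁, k₂ ∈ ℤ³ with k₂ ≠ 0 and k₁ + k₂ ≠ 0, one has |e^{−‖k₁+k₂‖² t} (k₁+k₂)_i 𝒫̂^{jl}(k₁+k₂) − e^{−‖k₂‖² t} (k₂)_i 𝒫̂^{jl}(k₂)| ≤ C ‖k₁‖^{η} t^{−(1−η)/2}. -/
/-- The Euclidean norm of a lattice point `k ∈ ℤ³`, regarded as a vector in `ℝ³`. -/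
noncomputable def zNorm (k : Fin 3 → ℤ) : ℝ :=
  Real.sqrt (∑ i, ((k i : ℝ)) ^ 2)

/-- The Fourier symbol of the Leray projection:
`𝒫̂^{lm}(k) = δ_{lm} - k_l k_m / ‖k‖²`. -/
noncomputable def leraySymbol (l m : Fin 3) (k : Fin 3 → ℤ) : ℝ :=
  (if l = m then 1 else 0) - (k l : ℝ) * (k m : ℝ) / zNorm k ^ 2

theorem zNorm_eq_norm (k : Fin 3 → ℤ) :
    zNorm k = ‖(WithLp.toLp 2 (fun i => (k i : ℝ)) : EuclideanSpace ℝ (Fin 3))‖ := by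
  simp [zNorm, EuclideanSpace.norm_eq]

theorem zNorm_nonneg (k : Fin 3 → ℤ) : 0 ≤ zNorm k := Real.sqrt_nonneg _

theorem abs_coord_le_zNorm (k : Fin 3 → ℤ) (i : Fin 3) : |(k i : ℝ)| ≤ zNorm k := by
  rw [zNorm_eq_norm]
  exact PiLp.norm_apply_le (WithLp.toLp 2 (fun i => (k i : ℝ)) : EuclideanSpace ℝ (Fin 3)) i

theorem zNorm_pos {k : Fin 3 → ℤ} (hk : k ≠ 0) : 0 < zNorm k := by
  obtain ⟨i, hi⟩ := Function.ne_iff.mp hk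
  exact (abs_pos.mpr (by exact_mod_cast hi)).trans_le (abs_coord_le_zNorm k i)

theorem abs_zNorm_add_sub_zNorm_le (k₁ k₂ : Fin 3 → ℤ) :
    |zNorm (k₁ + k₂) - zNorm k₂| ≤ zNorm k₁ := by
  simp only [zNorm_eq_norm]
  refine (abs_norm_sub_norm_le _ _).trans_eq ?_
  congr 1
  ext i
  simp

theorem mul_exp_neg_le_one (y : ℝ) : y * Real.exp (-y) ≤ 1 := by
  have h := Real.add_one_le_exp y
  rw [Real.exp_neg, ← div_eq_mul_inv, div_le_one (Real.exp_pos y)]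
  linarith

theorem exp_neg_sq_mul_mul_self_le {a t : ℝ} (ht : 0 < t) :
    Real.exp (-a ^ 2 * t) * a ≤ t ^ (-(1 / 2) : ℝ) := by
  have hs : 0 < √t := Real.sqrt_pos.mpr ht
  have hsq : √t ^ 2 = t := Real.sq_sqrt ht.le
  rw [Real.rpow_neg ht.le, ← Real.sqrt_eq_rpow, ← one_div, le_div_iff₀ hs]
  have h : a * √t ≤ Real.exp (a ^ 2 * t) := by
    have := Real.add_one_le_exp (a ^ 2 * t)
    nlinarith [sq_nonneg (a * √t - 1), sq_nonneg (a * √t), mul_pow a (√t) 2]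
  have he : Real.exp (-a ^ 2 * t) = (Real.exp (a ^ 2 * t))⁻¹ := by
    rw [← Real.exp_neg, neg_mul]
  rw [he, mul_assoc, inv_mul_le_iff₀ (Real.exp_pos _), mul_one]
  exact h

theorem abs_exp_neg_sq_mul_mul_self_sub_le_of_le {a b t : ℝ} (hb : 0 ≤ b) (hab : b ≤ a)
    (ht : 0 ≤ t) :
    |Real.exp (-a ^ 2 * t) * a - Real.exp (-b ^ 2 * t) * b| ≤ 3 * (a - b) := by
  have hmono : Real.exp (-a ^ 2 * t) ≤ Real.exp (-b ^ 2 * t) := by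
    apply Real.exp_le_exp.mpr
    nlinarith [mul_le_mul_of_nonneg_right (pow_le_pow_left₀ hb hab 2) ht]
  have hb1 : Real.exp (-b ^ 2 * t) ≤ 1 := Real.exp_le_one_iff.mpr (by nlinarith [sq_nonneg b])
  have ha0 := Real.exp_pos (-a ^ 2 * t)
  have hb0 := Real.exp_pos (-b ^ 2 * t)
  rw [abs_le]
  constructor
  · rcases le_total (2 * b) a with h2 | h2
    · have : Real.exp (-b ^ 2 * t) * b ≤ b := mul_le_of_le_one_left hb hb1
      have : 0 ≤ Real.exp (-a ^ 2 * t) * a := mul_nonneg ha0.le (hb.trans hab)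
      linarith
    · have hfac : Real.exp (-a ^ 2 * t)
          = Real.exp (-b ^ 2 * t) * Real.exp (-((a ^ 2 - b ^ 2) * t)) := by
        rw [← Real.exp_add]; ring_nf
      have hlow := Real.one_sub_le_exp_neg ((a ^ 2 - b ^ 2) * t)
      have hdiff : Real.exp (-b ^ 2 * t) - Real.exp (-a ^ 2 * t)
          ≤ Real.exp (-b ^ 2 * t) * ((a ^ 2 - b ^ 2) * t) := by
        rw [hfac]; nlinarith
      have hbt : b ^ 2 * t * Real.exp (-b ^ 2 * t) ≤ 1 := by
        simpa [neg_mul] using mul_exp_neg_le_one (b ^ 2 * t)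
      have key : b * (Real.exp (-b ^ 2 * t) - Real.exp (-a ^ 2 * t)) ≤ 3 * (a - b) :=
        calc b * (Real.exp (-b ^ 2 * t) - Real.exp (-a ^ 2 * t))
            ≤ b * (Real.exp (-b ^ 2 * t) * ((a ^ 2 - b ^ 2) * t)) := by gcongr
          _ = (Real.exp (-b ^ 2 * t) * t * b * (a - b)) * (a + b) := by ring
          _ ≤ (Real.exp (-b ^ 2 * t) * t * b * (a - b)) * (3 * b) := by
              have := sub_nonneg.mpr hab
              gcongr
              linarith
          _ = 3 * (a - b) * (b ^ 2 * t * Real.exp (-b ^ 2 * t)) := by ring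
          _ ≤ 3 * (a - b) := mul_le_of_le_one_right (by linarith) hbt
      nlinarith [mul_le_mul_of_nonneg_left hab ha0.le]
  · nlinarith [mul_le_mul_of_nonneg_right hmono (hb.trans hab),
      mul_le_mul_of_nonneg_right hb1 (sub_nonneg.mpr hab)]

theorem abs_exp_neg_sq_mul_mul_self_sub_le {a b t : ℝ} (ha : 0 ≤ a) (hb : 0 ≤ b)
    (ht : 0 ≤ t) :
    |Real.exp (-a ^ 2 * t) * a - Real.exp (-b ^ 2 * t) * b| ≤ 3 * |a - b| := by
  rcases le_total b a with h | h
  · rw [abs_of_nonneg (sub_nonneg.mpr h)]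
    exact abs_exp_neg_sq_mul_mul_self_sub_le_of_le hb h ht
  · rw [abs_sub_comm, abs_sub_comm a b, abs_of_nonneg (sub_nonneg.mpr h)]
    exact abs_exp_neg_sq_mul_mul_self_sub_le_of_le ha h ht

theorem mul_abs_div_sub_div_le {x y a b d : ℝ} (ha : 0 < a) (hb : 0 < b) (hx : |x| ≤ a)
    (hxy : |x - y| ≤ d) (hab : |a - b| ≤ d) : b * |x / a - y / b| ≤ 2 * d := by
  have h : b * (x / a - y / b) = (x / a) * (b - a) + (x - y) := by
    field_simp; ring
  have hu : |x / a| ≤ 1 := by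
    rw [abs_div, abs_of_pos ha]; exact (div_le_one ha).mpr hx
  calc b * |x / a - y / b| = |b * (x / a - y / b)| := by rw [abs_mul, abs_of_pos hb]
    _ ≤ |x / a| * |b - a| + |x - y| := by rw [h, ← abs_mul]; exact abs_add_le _ _
    _ ≤ 1 * d + d := by rw [abs_sub_comm b a]; gcongr
    _ = 2 * d := by ring

theorem abs_indicator_sub_mul_le_two {p : Prop} [Decidable p] {x y : ℝ} (hx : |x| ≤ 1)
    (hy : |y| ≤ 1) : |(if p then 1 else 0) - x * y| ≤ 2 := by
  have h : |x * y| ≤ 1 := by rw [abs_mul]; exact mul_le_one₀ hx (abs_nonneg _) hy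
  have := abs_le.mp h
  split_ifs <;> rw [abs_le] <;> constructor <;> linarith

theorem abs_mul_sub_mul_sub_le {e x₁ x₂ x₃ y₁ y₂ y₃ : ℝ} (he : |e - x₂ * x₃| ≤ 2)
    (hx : |x₃| ≤ 1) (hy₁ : |y₁| ≤ 1) (hy₂ : |y₂| ≤ 1) :
    |x₁ * (e - x₂ * x₃) - y₁ * (e - y₂ * y₃)|
      ≤ 2 * |x₁ - y₁| + |x₂ - y₂| + |x₃ - y₃| := by
  have h : x₁ * (e - x₂ * x₃) - y₁ * (e - y₂ * y₃)
      = (x₁ - y₁) * (e - x₂ * x₃) + (-y₁) * ((x₂ - y₂) * x₃ + y₂ * (x₃ - y₃)) := by ring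
  calc |x₁ * (e - x₂ * x₃) - y₁ * (e - y₂ * y₃)|
      ≤ |x₁ - y₁| * |e - x₂ * x₃| + |y₁| * (|x₂ - y₂| * |x₃| + |y₂| * |x₃ - y₃|) := by
        rw [h]
        refine (abs_add_le _ _).trans ?_
        rw [abs_mul, abs_mul, abs_neg]
        gcongr
        exact (abs_add_le _ _).trans_eq (by rw [abs_mul, abs_mul])
    _ ≤ |x₁ - y₁| * 2 + 1 * (|x₂ - y₂| * 1 + 1 * |x₃ - y₃|) := by gcongr
    _ = _ := by ring

theorem abs_coord_div_zNorm_le_one (k : Fin 3 → ℤ) (i : Fin 3) :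
    |(k i : ℝ) / zNorm k| ≤ 1 := by
  rw [abs_div, abs_of_nonneg (zNorm_nonneg k)]
  exact div_le_one_of_le₀ (abs_coord_le_zNorm k i) (zNorm_nonneg k)

theorem leraySymbol_eq (j l : Fin 3) (k : Fin 3 → ℤ) :
    leraySymbol j l k
      = (if j = l then 1 else 0) - (k j : ℝ) / zNorm k * ((k l : ℝ) / zNorm k) := by
  rw [leraySymbol, div_mul_div_comm, sq]

theorem abs_leraySymbol_le_two (j l : Fin 3) (k : Fin 3 → ℤ) : |leraySymbol j l k| ≤ 2 := by
  rw [leraySymbol_eq]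
  exact abs_indicator_sub_mul_le_two (abs_coord_div_zNorm_le_one k j)
    (abs_coord_div_zNorm_le_one k l)

theorem abs_heat_leray_symbol_le {t : ℝ} (ht : 0 < t) (i j l : Fin 3) (k : Fin 3 → ℤ) :
    |Real.exp (-zNorm k ^ 2 * t) * (k i : ℝ) * leraySymbol j l k|
      ≤ 2 * t ^ (-(1 / 2) : ℝ) := by
  rw [abs_mul, abs_mul, Real.abs_exp, mul_comm 2]
  refine mul_le_mul ?_ (abs_leraySymbol_le_two j l k) (abs_nonneg _) (by positivity)
  refine (mul_le_mul_of_nonneg_left (abs_coord_le_zNorm k i) (Real.exp_pos _).le).trans ?_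
  exact exp_neg_sq_mul_mul_self_le ht

theorem abs_heat_leray_symbol_sub_le {t : ℝ} (ht : 0 < t) (i j l : Fin 3)
    {k₁ k₂ : Fin 3 → ℤ} (hk₂ : k₂ ≠ 0) (hk : k₁ + k₂ ≠ 0) :
    |Real.exp (-zNorm (k₁ + k₂) ^ 2 * t) * ((k₁ + k₂) i : ℝ) * leraySymbol j l (k₁ + k₂)
        - Real.exp (-zNorm k₂ ^ 2 * t) * (k₂ i : ℝ) * leraySymbol j l k₂|
      ≤ 14 * zNorm k₁ := by
  have hu (m : Fin 3) : zNorm k₂ * |((k₁ + k₂) m : ℝ) / zNorm (k₁ + k₂)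
      - (k₂ m : ℝ) / zNorm k₂| ≤ 2 * zNorm k₁ :=
    mul_abs_div_sub_div_le (zNorm_pos hk) (zNorm_pos hk₂) (abs_coord_le_zNorm _ m)
      (by simpa using abs_coord_le_zNorm k₁ m) (abs_zNorm_add_sub_zNorm_le k₁ k₂)
  have hnorm := abs_zNorm_add_sub_zNorm_le k₁ k₂
  have hu₁ := abs_coord_div_zNorm_le_one (k₁ + k₂)
  have hv₁ := abs_coord_div_zNorm_le_one k₂
  have hPx := abs_leraySymbol_le_two j l (k₁ + k₂)
  rw [leraySymbol_eq] at hPx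
  rw [leraySymbol_eq, leraySymbol_eq]
  have ha := zNorm_pos hk
  have hb := zNorm_pos hk₂
  have hxi : ((k₁ + k₂) i : ℝ)
      = zNorm (k₁ + k₂) * (((k₁ + k₂) i : ℝ) / zNorm (k₁ + k₂)) := by field_simp
  have hyi : (k₂ i : ℝ) = zNorm k₂ * ((k₂ i : ℝ) / zNorm k₂) := by field_simp
  rw [hxi, hyi]
  have hh := abs_exp_neg_sq_mul_mul_self_sub_le ha.le hb.le ht.le
  have hH := abs_mul_sub_mul_sub_le (x₁ := ((k₁ + k₂) i : ℝ) / zNorm (k₁ + k₂))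
    (y₃ := (k₂ l : ℝ) / zNorm k₂) hPx (hu₁ l) (hv₁ i) (hv₁ j)
  have hui := hu₁ i
  have hdi := hu i
  have hdj := hu j
  have hdl := hu l
  have hE : Real.exp (-zNorm k₂ ^ 2 * t) ≤ 1 :=
    Real.exp_le_one_iff.mpr (by nlinarith [sq_nonneg (zNorm k₂)])
  have hE₀ := Real.exp_pos (-zNorm k₂ ^ 2 * t)
  have hd := zNorm_nonneg k₁
  generalize ((k₁ + k₂) i : ℝ) / zNorm (k₁ + k₂) = u₁ at *
  generalize ((k₁ + k₂) j : ℝ) / zNorm (k₁ + k₂) = u₂ at *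
  generalize ((k₁ + k₂) l : ℝ) / zNorm (k₁ + k₂) = u₃ at *
  generalize (k₂ i : ℝ) / zNorm k₂ = v₁ at *
  generalize (k₂ j : ℝ) / zNorm k₂ = v₂ at *
  generalize (k₂ l : ℝ) / zNorm k₂ = v₃ at *
  generalize (if j = l then (1 : ℝ) else 0) = e at *
  generalize Real.exp (-zNorm k₂ ^ 2 * t) = E at *
  generalize Real.exp (-zNorm (k₁ + k₂) ^ 2 * t) = E' at *
  generalize zNorm k₂ = b at *
  generalize zNorm (k₁ + k₂) = a at *
  have hbH : b * |u₁ * (e - u₂ * u₃) - v₁ * (e - v₂ * v₃)| ≤ 8 * zNorm k₁ :=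
    (mul_le_mul_of_nonneg_left hH hb.le).trans (by linarith)
  calc |E' * (a * u₁) * (e - u₂ * u₃) - E * (b * v₁) * (e - v₂ * v₃)|
      = |(E' * a - E * b) * (u₁ * (e - u₂ * u₃))
          + E * (b * (u₁ * (e - u₂ * u₃) - v₁ * (e - v₂ * v₃)))| := by ring_nf
    _ ≤ |E' * a - E * b| * (|u₁| * |e - u₂ * u₃|)
          + E * (b * |u₁ * (e - u₂ * u₃) - v₁ * (e - v₂ * v₃)|) := by
        refine (abs_add_le _ _).trans_eq ?_
        simp only [abs_mul, abs_of_pos hE₀, abs_of_pos hb]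
    _ ≤ (3 * zNorm k₁) * (1 * 2) + 1 * (8 * zNorm k₁) := by
        gcongr
        linarith
    _ = 14 * zNorm k₁ := by ring

theorem le_rpow_mul_rpow_of_le {D A B η : ℝ} (hD : 0 ≤ D) (h₀ : 0 ≤ η) (h₁ : η ≤ 1)
    (hA : D ≤ A) (hB : D ≤ B) : D ≤ A ^ η * B ^ (1 - η) := by
  calc D = D ^ η * D ^ (1 - η) := by
        rw [← Real.rpow_add_of_nonneg hD h₀ (by linarith)]; simp
    _ ≤ A ^ η * B ^ (1 - η) :=
        mul_le_mul (Real.rpow_le_rpow hD hA h₀) (Real.rpow_le_rpow hD hB (by linarith))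
          (Real.rpow_nonneg hD _) (Real.rpow_nonneg (hD.trans hA) _)

/-- Lemma 2.8: for every `η ∈ (0,1)` and indices `i, j, l`, there is `C > 0` such that for
all `t > 0` and lattice points `k₁, k₂` with `k₂ ≠ 0` and `k₁ + k₂ ≠ 0`,
`|e^{-‖k₁+k₂‖² t} (k₁+k₂)_i 𝒫̂^{jl}(k₁+k₂) - e^{-‖k₂‖² t} (k₂)_i 𝒫̂^{jl}(k₂)|
  ≤ C ‖k₁‖^η t^{-(1-η)/2}`. -/
theorem heat_leray_symbol_difference_bound
    (η : ℝ) (hη : η ∈ Set.Ioo (0 : ℝ) 1) (i j l : Fin 3) :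
    ∃ C : ℝ, 0 < C ∧ ∀ t : ℝ, 0 < t → ∀ k₁ k₂ : Fin 3 → ℤ, k₂ ≠ 0 → k₁ + k₂ ≠ 0 →
      |Real.exp (-zNorm (k₁ + k₂) ^ 2 * t) * ((k₁ + k₂) i : ℝ) * leraySymbol j l (k₁ + k₂)
          - Real.exp (-zNorm k₂ ^ 2 * t) * (k₂ i : ℝ) * leraySymbol j l k₂|
        ≤ C * zNorm k₁ ^ η * t ^ (-(1 - η) / 2) := by
  refine ⟨14 ^ η * 4 ^ (1 - η), by positivity, fun t ht k₁ k₂ hk₂ hk => ?_⟩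
  have hB := (abs_sub _ _).trans (add_le_add (abs_heat_leray_symbol_le ht i j l (k₁ + k₂))
    (abs_heat_leray_symbol_le ht i j l k₂))
  refine (le_rpow_mul_rpow_of_le (abs_nonneg _) hη.1.le hη.2.le
    (abs_heat_leray_symbol_sub_le ht i j l hk₂ hk) hB).trans_eq ?_
  rw [show 2 * t ^ (-(1 / 2) : ℝ) + 2 * t ^ (-(1 / 2) : ℝ) = 4 * t ^ (-(1 / 2) : ℝ) by ring,
    Real.mul_rpow (by norm_num) (zNorm_nonneg k₁), Real.mul_rpow (by norm_num) (by positivity),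
    ← Real.rpow_mul ht.le, show -(1 / 2) * (1 - η) = -(1 - η) / 2 by ring]
  ring
end

section
/- Let f : ℝ³ → ℝ be a smooth compactly supported function with f(0) = 1, and fix i ∈ {1,2,3}. For ε > 0 define C^ε = (2π)^{−3/2} ∑_{k ∈ ℤ³ \ {0}} ∑_{i₁=1}^{3} [ f(εk)² / (2‖k‖²) ] · 𝒫̂^{i i₁}(k) · 𝒫̂^{i i₁}(k) (a finite sum for each ε since f has compact support). Then C^ε tends to +∞ as ε → 0⁺. -/
/-- The lattice point with `i`-th coordinate `0` and remaining coordinates `n + 1` and `a`. -/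
def orthogonalPoint (i : Fin 3) (n a : ℕ) : Fin 3 → ℤ :=
  fun j => if j = i then 0 else if j = i + 1 then (n : ℤ) + 1 else (a : ℤ)

theorem orthogonalPoint_injective (i : Fin 3) :
    Function.Injective fun p : (_ : ℕ) × ℕ => orthogonalPoint i p.1 p.2 := by
  rintro ⟨n, a⟩ ⟨m, b⟩ h
  have h1 := congrFun h (i + 1)
  have h2 := congrFun h (i + 2)
  have hnm : n = m := by fin_cases i <;> simpa [orthogonalPoint] using h1
  have hab : a = b := by fin_cases i <;> simpa [orthogonalPoint] using h2
  rw [hnm, hab]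

theorem orthogonalPoint_ne_zero (i : Fin 3) (n a : ℕ) : orthogonalPoint i n a ≠ 0 := by
  intro h
  have h1 := congrFun h (i + 1)
  have h2 : (n : ℤ) + 1 = 0 := by fin_cases i <;> simpa [orthogonalPoint] using h1
  omega

theorem zNorm_sq (k : Fin 3 → ℤ) : zNorm k ^ 2 = ∑ i, (k i : ℝ) ^ 2 :=
  Real.sq_sqrt (by positivity)

theorem zNorm_orthogonalPoint_sq (i : Fin 3) (n a : ℕ) :
    zNorm (orthogonalPoint i n a) ^ 2 = ((n : ℝ) + 1) ^ 2 + (a : ℝ) ^ 2 := by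
  rw [zNorm_sq, Fin.sum_univ_three]
  fin_cases i <;> simp [orthogonalPoint] <;> ring

theorem leraySymbol_orthogonalPoint (i : Fin 3) (n a : ℕ) :
    leraySymbol i i (orthogonalPoint i n a) = 1 := by
  simp [leraySymbol, orthogonalPoint]

/-- The summand of the renormalization constant, with `c` the value of the cutoff at `k`. -/
noncomputable def renormalizationTerm (i : Fin 3) (c : ℝ) (k : Fin 3 → ℤ) : ℝ :=
  if k ≠ 0 then
    ∑ i₁ : Fin 3, c ^ 2 / (2 * zNorm k ^ 2) * leraySymbol i i₁ k * leraySymbol i i₁ k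
  else 0

theorem renormalizationTerm_nonneg (i : Fin 3) (c : ℝ) (k : Fin 3 → ℤ) :
    0 ≤ renormalizationTerm i c k := by
  unfold renormalizationTerm
  split_ifs
  · refine Finset.sum_nonneg fun j _ => ?_
    rw [mul_assoc]
    exact mul_nonneg (by positivity) (mul_self_nonneg _)
  · exact le_rfl

theorem renormalizationTerm_zero (i : Fin 3) (k : Fin 3 → ℤ) :
    renormalizationTerm i 0 k = 0 := by
  simp [renormalizationTerm]

theorem continuous_renormalizationTerm (i : Fin 3) (k : Fin 3 → ℤ) :
    Continuous fun c => renormalizationTerm i c k := by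
  unfold renormalizationTerm
  split_ifs <;> fun_prop

theorem le_renormalizationTerm_orthogonalPoint (i : Fin 3) {n a : ℕ} (ha : a ≤ n) :
    1 / (4 * ((n : ℝ) + 1) ^ 2) ≤ renormalizationTerm i 1 (orthogonalPoint i n a) := by
  have ha' : (a : ℝ) ≤ n := by exact_mod_cast ha
  rw [renormalizationTerm, if_pos (orthogonalPoint_ne_zero i n a)]
  refine le_trans ?_ (Finset.single_le_sum (fun j _ => ?_) (Finset.mem_univ i))
  · rw [leraySymbol_orthogonalPoint, zNorm_orthogonalPoint_sq, mul_one, mul_one, one_pow]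
    refine one_div_le_one_div_of_le (by positivity) ?_
    nlinarith [(Nat.cast_nonneg a : (0 : ℝ) ≤ a)]
  · rw [mul_assoc]
    exact mul_nonneg (by positivity) (mul_self_nonneg _)

theorem exists_lt_sum_renormalizationTerm (i : Fin 3) (C : ℝ) :
    ∃ S : Finset (Fin 3 → ℤ), C < ∑ k ∈ S, renormalizationTerm i 1 k := by
  obtain ⟨N, hN⟩ := (Real.tendsto_sum_range_one_div_nat_succ_atTop.eventually_gt_atTop
    (4 * C)).exists
  refine ⟨((Finset.range N).sigma fun n => Finset.range (n + 1)).map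
    ⟨_, orthogonalPoint_injective i⟩, ?_⟩
  rw [Finset.sum_map, Finset.sum_sigma]
  calc C < (1 / 4) * ∑ n ∈ Finset.range N, 1 / ((n : ℝ) + 1) := by linarith
    _ = ∑ n ∈ Finset.range N, (1 / 4) * (1 / ((n : ℝ) + 1)) := Finset.mul_sum _ _ _
    _ ≤ _ := Finset.sum_le_sum fun n _ => ?_
  calc (1 / 4) * (1 / ((n : ℝ) + 1))
      = ∑ a ∈ Finset.range (n + 1), 1 / (4 * ((n : ℝ) + 1) ^ 2) := by
        rw [Finset.sum_const, Finset.card_range, nsmul_eq_mul]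
        push_cast
        field_simp
    _ ≤ _ := Finset.sum_le_sum fun a ha =>
        le_renormalizationTerm_orthogonalPoint i (Nat.lt_succ_iff.mp (Finset.mem_range.mp ha))

theorem HasCompactSupport.finite_support_comp_intCast {ι : Type*} [Fintype ι]
    {f : (ι → ℝ) → ℝ} (hf : HasCompactSupport f) {ε : ℝ} (hε : 0 < ε) :
    {k : ι → ℤ | f (fun j => ε * (k j : ℝ)) ≠ 0}.Finite := by
  classical
  obtain ⟨R, hR⟩ := hf.isCompact.isBounded.exists_norm_le
  refine (Set.finite_Icc (fun _ : ι => -⌈R / ε⌉) (fun _ : ι => ⌈R / ε⌉)).subset fun k hk => ?_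
  have hbound (j : ι) : |(k j : ℝ)| ≤ ⌈R / ε⌉ := by
    refine le_trans ?_ (Int.le_ceil _)
    have h := (norm_le_pi_norm _ j).trans (hR _ (subset_tsupport f hk))
    rw [Real.norm_eq_abs, abs_mul, abs_of_pos hε] at h
    rwa [le_div_iff₀ hε, mul_comm]
  have hbound' (j : ι) : |k j| ≤ ⌈R / ε⌉ := by exact_mod_cast hbound j
  exact ⟨fun j => (abs_le.mp (hbound' j)).1, fun j => (abs_le.mp (hbound' j)).2⟩

theorem summable_renormalizationTerm {f : (Fin 3 → ℝ) → ℝ} (hf : HasCompactSupport f)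
    (i : Fin 3) {ε : ℝ} (hε : 0 < ε) :
    Summable fun k : Fin 3 → ℤ => renormalizationTerm i (f fun j => ε * (k j : ℝ)) k := by
  refine summable_of_hasFiniteSupport ((hf.finite_support_comp_intCast hε).subset fun k hk => ?_)
  intro h
  exact hk (by simp only [h, renormalizationTerm_zero])

theorem tendsto_tsum_renormalizationTerm {f : (Fin 3 → ℝ) → ℝ} (hf : Continuous f)
    (hsupp : HasCompactSupport f) (h0 : f 0 = 1) (i : Fin 3) :
    Filter.Tendsto
      (fun ε : ℝ => ∑' k : Fin 3 → ℤ, renormalizationTerm i (f fun j => ε * (k j : ℝ)) k)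
      (nhdsWithin 0 (Set.Ioi 0)) Filter.atTop := by
  refine Filter.tendsto_atTop.mpr fun C => ?_
  obtain ⟨S, hS⟩ := exists_lt_sum_renormalizationTerm i C
  have hcont : Continuous fun ε : ℝ =>
      ∑ k ∈ S, renormalizationTerm i (f fun j => ε * (k j : ℝ)) k :=
    continuous_finsetSum _ fun k _ =>
      (continuous_renormalizationTerm i k).comp (hf.comp (by fun_prop))
  have hlim : C < ∑ k ∈ S, renormalizationTerm i (f fun j => (0 : ℝ) * (k j : ℝ)) k := by
    have hz : (fun _ : Fin 3 => (0 : ℝ)) = 0 := rfl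
    simpa only [zero_mul, hz, h0] using hS
  filter_upwards [nhdsWithin_le_nhds (hcont.continuousAt.eventually_const_lt hlim),
    self_mem_nhdsWithin] with ε hε hpos
  exact hε.le.trans ((summable_renormalizationTerm hsupp i hpos).sum_le_tsum S
    fun k _ => renormalizationTerm_nonneg i _ k)

/-- Divergence of the renormalization constant `C₀,₁^{ε,ii}` of (117): for a smooth
compactly supported `f : ℝ³ → ℝ` with `f(0) = 1`,
`C^ε = (2π)^{-3/2} ∑_{k ≠ 0} ∑_{i₁} f(εk)²/(2‖k‖²) 𝒫̂^{ii₁}(k) 𝒫̂^{ii₁}(k)` tends to `+∞`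
as `ε → 0⁺`. -/
theorem renormalization_constant_diverges
    (f : (Fin 3 → ℝ) → ℝ) (hf : ContDiff ℝ (⊤ : ℕ∞) f)
    (hsupp : HasCompactSupport f) (h0 : f 0 = 1) (i : Fin 3) :
    Filter.Tendsto
      (fun ε : ℝ => (2 * Real.pi) ^ (-(3 : ℝ) / 2) *
        ∑' k : Fin 3 → ℤ,
          if k ≠ 0 then
            ∑ i₁ : Fin 3,
              f (fun j => ε * (k j : ℝ)) ^ 2 / (2 * zNorm k ^ 2)
                * leraySymbol i i₁ k * leraySymbol i i₁ k
          else 0)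
      (nhdsWithin 0 (Set.Ioi 0)) Filter.atTop := by
  exact (tendsto_tsum_renormalizationTerm hf.continuous hsupp h0 i).const_mul_atTop
    (by positivity)
end
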